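/- arXiv:2405.19863 — 2 statements merged into one kernel-verified Lean document; each statement's English description precedes it below -/
import Mathlib

section
/- Let ξ = (ξ⁰,ξ¹): H → E be an embedding pair. Then the relations ∼_ξ and ∼_ae on E^{-∞} are equal: for all μ, ν ∈ E^{-∞}, μ ∼_ξ ν if and only if μ ∼_ae ν. -/
open scoped Classical

/-- An embedding pair `ξ = (ξ⁰,ξ¹) : H → E`: two injective homomorphisms of finite directed
graphs that agree on vertices and have disjoint images on edges. -/
structure EmbPair where
  HV : Type
  HE : Type
  EV : Type
  EE : Type
  finHV : Fintype HV
  finHE : Fintype HE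
  finEV : Fintype EV
  finEE : Fintype EE
  rH : HE → HV
  sH : HE → HV
  rE : EE → EV
  sE : EE → EV
  ξV : HV → EV
  ξ0 : HE → EE
  ξ1 : HE → EE
  injV : Function.Injective ξV
  inj0 : Function.Injective ξ0
  inj1 : Function.Injective ξ1
  r0 : ∀ h, rE (ξ0 h) = ξV (rH h)
  s0 : ∀ h, sE (ξ0 h) = ξV (sH h)
  r1 : ∀ h, rE (ξ1 h) = ξV (rH h)
  s1 : ∀ h, sE (ξ1 h) = ξV (sH h)
  disj : ∀ h h', ξ0 h ≠ ξ1 h'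

namespace EmbPair

variable (X : EmbPair)

/-- `H¹_ξ = ξ⁰(H¹) ∪ ξ¹(H¹)`. -/
def Hxi : Set X.EE := Set.range X.ξ0 ∪ Set.range X.ξ1

/-- The action of `(m,v)` on an edge `e` with `r(e) = v`: it fixes `e ∉ H¹_ξ`, and maps
`ξ^i(h)` to `ξ^j(h)` where `m + i = 2n + j`, `j ∈ {0,1}`. -/
noncomputable def edgeAct (m : ℤ) (e : X.EE) : X.EE :=
  if h0 : ∃ h, X.ξ0 h = e then
    (if m % 2 = 0 then X.ξ0 h0.choose else X.ξ1 h0.choose)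
  else if h1 : ∃ h, X.ξ1 h = e then
    (if (m + 1) % 2 = 0 then X.ξ0 h1.choose else X.ξ1 h1.choose)
  else e

/-- The restriction of `(m,v)` along an edge `e` with `r(e) = v`: it is `0` when
`e ∉ H¹_ξ`, and `n` with `m + i = 2n + j`, `j ∈ {0,1}`, when `e = ξ^i(h)`. -/
noncomputable def edgeRes (m : ℤ) (e : X.EE) : ℤ :=
  if _ : ∃ h, X.ξ0 h = e then m / 2
  else if _ : ∃ h, X.ξ1 h = e then (m + 1) / 2
  else 0

/-- Action on finite paths: `(m,v)·(eν) = ((m,v)·e)((m,v)|_e·ν)`. -/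
noncomputable def act : ℤ → List X.EE → List X.EE
  | _, [] => []
  | m, e :: ν => X.edgeAct m e :: act (X.edgeRes m e) ν

/-- Restriction along finite paths: `(m,v)|_{eν} = ((m,v)|_e)|_ν`. -/
noncomputable def res : ℤ → List X.EE → ℤ
  | m, [] => m
  | m, e :: ν => res (X.edgeRes m e) ν

/-- A finite path in `E`. -/
def IsPath (μ : List X.EE) : Prop := μ.Chain' (fun e f => X.sE e = X.rE f)

/-- `r(μ) = v` (vacuously true for the empty path). -/
def rangeIs (μ : List X.EE) (v : X.EV) : Prop := ∀ e ∈ μ.head?, X.rE e = v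

/-- The source of a path with range `v`. -/
def src (v : X.EV) (μ : List X.EE) : X.EV := (μ.getLast?).elim v X.sE

/-- A left-infinite path `⋯μ₋₂μ₋₁` in `E`; index `p : ℕ` encodes position `-(p+1)`. -/
def IsLPath (μ : ℕ → X.EE) : Prop := ∀ n, X.sE (μ (n + 1)) = X.rE (μ n)

/-- The finite segment `μ₋ₖ⋯μ₋₁` of a left-infinite path. -/
def seg (μ : ℕ → X.EE) (k : ℕ) : List X.EE := ((List.range k).reverse).map μ

/-- Asymptotic equivalence of left-infinite paths in `E`. -/
def AsympEquiv (μ ν : ℕ → X.EE) : Prop :=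
  ∃ F : Finset ℤ, ∃ g : ℕ → ℤ, ∀ n : ℕ,
    g n ∈ F ∧ X.rE (μ n) = X.rE (ν n) ∧ X.act (g n) (X.seg μ (n + 1)) = X.seg ν (n + 1)

/-- `ξ^b` for a bit `b`. -/
def xiB (b : Bool) : X.HE → X.EE := fun h => bif b then X.ξ1 h else X.ξ0 h

end EmbPair

namespace EmbPair

variable (X : EmbPair)

/-- Putnam's relation `∼ξ` on left-infinite paths (positions: `n = -(n'+1)`). -/
def PutnamRel (μ ν : ℕ → X.EE) : Prop :=
  μ = ν ∨ ∃ n' : ℕ, ∃ b : Bool, ∃ y : ℕ → X.HE,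
    (∀ p : ℕ, n' ≤ p → μ p = X.xiB b (y p) ∧ ν p = X.xiB (!b) (y p)) ∧
    (n' = 0 ∨
      (1 ≤ n' ∧ (∀ p : ℕ, p < n' - 1 → μ p = ν p) ∧
        ∃ y' : X.HE, μ (n' - 1) = X.xiB (!b) y' ∧ ν (n' - 1) = X.xiB b y') ∨
      (1 ≤ n' ∧ (∀ p : ℕ, p < n' → μ p = ν p) ∧ μ (n' - 1) ∉ X.Hxi))

end EmbPair

namespace EmbPair

variable (X : EmbPair)

/-- The integer `1` or `-1` which carries through edges of the form `ξ^b(h)`. -/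
def carry (b : Bool) : ℤ := bif b then 1 else -1

lemma eq_carry_of_abs_le_one {m : ℤ} (hm : |m| ≤ 1) (h0 : m ≠ 0) : ∃ b, m = carry b := by
  rw [abs_le] at hm
  rcases (by omega : m = 1 ∨ m = -1) with h | h
  · exact ⟨true, h⟩
  · exact ⟨false, h⟩

lemma xiB_injective (b : Bool) : Function.Injective (X.xiB b) := by
  cases b
  · exact X.inj0
  · exact X.inj1

lemma xiB_ne_xiB_not (b : Bool) (h h' : X.HE) : X.xiB b h ≠ X.xiB (!b) h' := by
  cases b
  · exact X.disj h h'
  · exact (X.disj h' h).symm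

lemma eq_of_xiB_eq {b b' : Bool} {h h' : X.HE} (e : X.xiB b h = X.xiB b' h') : b = b' := by
  by_contra hne
  obtain rfl : b' = !b := by cases b <;> cases b' <;> simp_all
  exact X.xiB_ne_xiB_not b h h' e

lemma rE_xiB (b b' : Bool) (h : X.HE) : X.rE (X.xiB b h) = X.rE (X.xiB b' h) := by
  cases b <;> cases b' <;> simp [xiB, X.r0, X.r1]

lemma exists_xiB_of_mem_Hxi {e : X.EE} (he : e ∈ X.Hxi) (b : Bool) :
    (∃ h, e = X.xiB b h) ∨ ∃ h, e = X.xiB (!b) h := by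
  rcases he with ⟨h, rfl⟩ | ⟨h, rfl⟩ <;> cases b
  · exact Or.inl ⟨h, rfl⟩
  · exact Or.inr ⟨h, rfl⟩
  · exact Or.inr ⟨h, rfl⟩
  · exact Or.inl ⟨h, rfl⟩

lemma edgeAct_ξ0 (m : ℤ) (h : X.HE) :
    X.edgeAct m (X.ξ0 h) = if m % 2 = 0 then X.ξ0 h else X.ξ1 h := by
  have hex : ∃ h', X.ξ0 h' = X.ξ0 h := ⟨h, rfl⟩
  rw [edgeAct, dif_pos hex, X.inj0 hex.choose_spec]

lemma edgeAct_ξ1 (m : ℤ) (h : X.HE) :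
    X.edgeAct m (X.ξ1 h) = if (m + 1) % 2 = 0 then X.ξ0 h else X.ξ1 h := by
  have hex : ∃ h', X.ξ1 h' = X.ξ1 h := ⟨h, rfl⟩
  have hno : ¬ ∃ h', X.ξ0 h' = X.ξ1 h := fun ⟨h', e⟩ => X.disj h' h e
  rw [edgeAct, dif_neg hno, dif_pos hex, X.inj1 hex.choose_spec]

lemma edgeRes_ξ0 (m : ℤ) (h : X.HE) : X.edgeRes m (X.ξ0 h) = m / 2 := by
  rw [edgeRes, dif_pos ⟨h, rfl⟩]

lemma edgeRes_ξ1 (m : ℤ) (h : X.HE) : X.edgeRes m (X.ξ1 h) = (m + 1) / 2 := by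
  have hno : ¬ ∃ h', X.ξ0 h' = X.ξ1 h := fun ⟨h', e⟩ => X.disj h' h e
  rw [edgeRes, dif_neg hno, dif_pos ⟨h, rfl⟩]

lemma edgeAct_of_notMem {e : X.EE} (he : e ∉ X.Hxi) (m : ℤ) : X.edgeAct m e = e := by
  have h0 : ¬ ∃ h, X.ξ0 h = e := fun h => he (Or.inl h)
  have h1 : ¬ ∃ h, X.ξ1 h = e := fun h => he (Or.inr h)
  rw [edgeAct, dif_neg h0, dif_neg h1]

lemma edgeRes_of_notMem {e : X.EE} (he : e ∉ X.Hxi) (m : ℤ) : X.edgeRes m e = 0 := by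
  have h0 : ¬ ∃ h, X.ξ0 h = e := fun h => he (Or.inl h)
  have h1 : ¬ ∃ h, X.ξ1 h = e := fun h => he (Or.inr h)
  rw [edgeRes, dif_neg h0, dif_neg h1]

lemma edgeAct_zero (e : X.EE) : X.edgeAct 0 e = e := by
  by_cases he : e ∈ X.Hxi
  · rcases he with ⟨h, rfl⟩ | ⟨h, rfl⟩
    · simp [edgeAct_ξ0]
    · simp [edgeAct_ξ1]
  · exact X.edgeAct_of_notMem he 0

lemma edgeRes_zero (e : X.EE) : X.edgeRes 0 e = 0 := by
  by_cases he : e ∈ X.Hxi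
  · rcases he with ⟨h, rfl⟩ | ⟨h, rfl⟩
    · simp [edgeRes_ξ0]
    · simp [edgeRes_ξ1]
  · exact X.edgeRes_of_notMem he 0

lemma edgeAct_carry (b b' : Bool) (h : X.HE) :
    X.edgeAct (carry b) (X.xiB b' h) = X.xiB (!b') h := by
  cases b <;> cases b' <;> simp [carry, xiB, edgeAct_ξ0, edgeAct_ξ1]

lemma edgeRes_carry (b : Bool) (h : X.HE) : X.edgeRes (carry b) (X.xiB b h) = carry b := by
  cases b <;> simp [carry, xiB, edgeRes_ξ0, edgeRes_ξ1]

lemma edgeRes_carry_not (b : Bool) (h : X.HE) : X.edgeRes (carry b) (X.xiB (!b) h) = 0 := by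
  cases b <;> simp [carry, xiB, edgeRes_ξ0, edgeRes_ξ1]

lemma abs_edgeRes_le {m k : ℤ} (hk : 1 ≤ k) (hm : |m| ≤ k + 1) (e : X.EE) :
    |X.edgeRes m e| ≤ k := by
  rw [abs_le] at hm ⊢
  by_cases he : e ∈ X.Hxi
  · rcases he with ⟨h, rfl⟩ | ⟨h, rfl⟩
    · rw [edgeRes_ξ0]; omega
    · rw [edgeRes_ξ1]; omega
  · rw [X.edgeRes_of_notMem he]; omega

lemma act_zero (l : List X.EE) : X.act 0 l = l := by
  induction l with
  | nil => rfl
  | cons e l ih => rw [act, edgeAct_zero, edgeRes_zero, ih]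

lemma seg_succ (μ : ℕ → X.EE) (n : ℕ) : X.seg μ (n + 1) = μ n :: X.seg μ n := by
  simp [seg, List.range_succ]

lemma seg_eq_seg_iff (μ ν : ℕ → X.EE) (n : ℕ) :
    X.seg μ n = X.seg ν n ↔ ∀ p < n, μ p = ν p := by
  simp [seg]

lemma act_seg_succ_iff (μ ν : ℕ → X.EE) (m : ℤ) (n : ℕ) :
    X.act m (X.seg μ (n + 1)) = X.seg ν (n + 1) ↔
      X.edgeAct m (μ n) = ν n ∧ X.act (X.edgeRes m (μ n)) (X.seg μ n) = X.seg ν n := by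
  rw [seg_succ, seg_succ, act, List.cons.injEq]

lemma exists_abs_le_one_of_act_seg (μ ν : ℕ → X.EE) (k : ℕ) :
    ∀ (m : ℤ) (n : ℕ), |m| ≤ k + 1 → X.act m (X.seg μ (n + k)) = X.seg ν (n + k) →
      ∃ m' : ℤ, |m'| ≤ 1 ∧ X.act m' (X.seg μ n) = X.seg ν n := by
  induction k with
  | zero => exact fun m n hm h => ⟨m, by simpa using hm, h⟩
  | succ k ih =>
    intro m n hm h
    rw [← Nat.add_assoc, act_seg_succ_iff] at h
    exact ih _ n (X.abs_edgeRes_le (by omega) (by push_cast at hm; exact hm) _) h.2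

lemma AsympEquiv.exists_abs_le_one {X : EmbPair} {μ ν : ℕ → X.EE} (h : X.AsympEquiv μ ν) (n : ℕ) :
    ∃ m : ℤ, |m| ≤ 1 ∧ X.act m (X.seg μ n) = X.seg ν n := by
  obtain ⟨F, g, hg⟩ := h
  set k : ℕ := F.sup Int.natAbs
  have hk : (g (n + k)).natAbs ≤ k := Finset.le_sup (f := Int.natAbs) (hg (n + k)).1
  have hact := (hg (n + k)).2.2
  rw [show n + k + 1 = n + (k + 1) by omega] at hact
  refine X.exists_abs_le_one_of_act_seg μ ν (k + 1) _ n ?_ hact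
  rw [Int.abs_eq_natAbs]
  omega

/-- If `μ` and `ν` differ at position `p₀`, an action of `m` with `|m| ≤ 1` taking `μ` to `ν` must
carry all the way through to `p₀`. -/
lemma exists_carry_of_act_seg {μ ν : ℕ → X.EE} {p₀ : ℕ} (hne : μ p₀ ≠ ν p₀) {n : ℕ}
    (hn : p₀ + 1 ≤ n) : ∀ m : ℤ, |m| ≤ 1 → X.act m (X.seg μ n) = X.seg ν n →
      ∃ b, m = carry b ∧ X.act (carry b) (X.seg μ (p₀ + 1)) = X.seg ν (p₀ + 1) ∧
        ∀ p, p₀ < p → p < n → ∃ y, μ p = X.xiB b y ∧ ν p = X.xiB (!b) y := by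
  have key : ∀ n, p₀ + 1 ≤ n → X.act 0 (X.seg μ n) ≠ X.seg ν n := fun n hn h => by
    rw [act_zero, seg_eq_seg_iff] at h
    exact hne (h p₀ hn)
  induction n, hn using Nat.le_induction with
  | base =>
    intro m hm h
    obtain ⟨b, rfl⟩ := eq_carry_of_abs_le_one hm (by rintro rfl; exact key _ le_rfl h)
    exact ⟨b, rfl, h, fun p h1 h2 => by omega⟩
  | succ n hn ih =>
    intro m hm h
    obtain ⟨b, rfl⟩ := eq_carry_of_abs_le_one hm (by rintro rfl; exact key _ (by omega) h)
    rw [act_seg_succ_iff] at h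
    obtain ⟨hhead, htail⟩ := h
    by_cases he : μ n ∈ X.Hxi
    · rcases X.exists_xiB_of_mem_Hxi he b with ⟨y, hy⟩ | ⟨y, hy⟩
      · rw [hy, edgeRes_carry] at htail
        rw [hy, edgeAct_carry] at hhead
        obtain ⟨b', hb, hact, hall⟩ := ih _ hm htail
        obtain rfl : b = b' := by
          cases b <;> cases b' <;> simp_all [carry]
        refine ⟨b, rfl, hact, fun p h1 h2 => ?_⟩
        rcases Nat.lt_succ_iff_lt_or_eq.1 h2 with h2 | rfl
        · exact hall p h1 h2
        · exact ⟨y, hy, hhead.symm⟩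
      · rw [hy, edgeRes_carry_not] at htail
        exact absurd htail (key n hn)
    · rw [X.edgeRes_of_notMem he] at htail
      exact absurd htail (key n hn)

lemma exists_seq_of_forall_ge {α : Type*} {P : ℕ → α → Prop} {n : ℕ}
    (h : ∀ p, n ≤ p → ∃ y, P p y) : ∃ y : ℕ → α, ∀ p, n ≤ p → P p (y p) := by
  have h' : ∀ p, ∃ y, n ≤ p → P p y := fun p => by
    by_cases hp : n ≤ p
    · exact (h p hp).imp fun y hy _ => hy
    · exact (h n le_rfl).imp fun y _ hp' => absurd hp' hp
  exact ⟨fun p => (h' p).choose, fun p => (h' p).choose_spec⟩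

lemma AsympEquiv.putnamRel {X : EmbPair} {μ ν : ℕ → X.EE} (h : X.AsympEquiv μ ν) :
    X.PutnamRel μ ν := by
  by_cases hμν : μ = ν
  · exact Or.inl hμν
  right
  have hex : ∃ p, μ p ≠ ν p := Function.ne_iff.1 hμν
  obtain ⟨p₀, hne, hmin⟩ : ∃ p₀, μ p₀ ≠ ν p₀ ∧ ∀ p < p₀, μ p = ν p :=
    ⟨Nat.find hex, Nat.find_spec hex, fun p hp => not_not.1 (Nat.find_min hex hp)⟩
  obtain ⟨m, hm, hmact⟩ := h.exists_abs_le_one (p₀ + 2)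
  obtain ⟨b, -, hact, hb⟩ := X.exists_carry_of_act_seg hne (by omega) m hm hmact
  obtain ⟨y₁, hy₁, -⟩ := hb (p₀ + 1) (by omega) (by omega)
  have htail : ∀ p, p₀ + 1 ≤ p → ∃ y, μ p = X.xiB b y ∧ ν p = X.xiB (!b) y := by
    intro p hp
    obtain ⟨m', hm', hmact'⟩ := h.exists_abs_le_one (p + 1)
    obtain ⟨b', -, -, hb'⟩ := X.exists_carry_of_act_seg hne (by omega) m' hm' hmact'
    obtain ⟨y₂, hy₂, -⟩ := hb' (p₀ + 1) (by omega) (by omega)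
    obtain rfl : b = b' := X.eq_of_xiB_eq (hy₁.symm.trans hy₂)
    exact hb' p (by omega) (by omega)
  rw [act_seg_succ_iff] at hact
  obtain ⟨hhead, hrest⟩ := hact
  have he : μ p₀ ∈ X.Hxi := by
    by_contra he
    exact hne (by rw [← hhead, X.edgeAct_of_notMem he])
  rcases X.exists_xiB_of_mem_Hxi he b with ⟨y₀, hy₀⟩ | ⟨y₀, hy₀⟩
  · rw [hy₀, edgeAct_carry] at hhead
    rw [hy₀, edgeRes_carry] at hrest
    have htail' : ∀ p, p₀ ≤ p → ∃ y, μ p = X.xiB b y ∧ ν p = X.xiB (!b) y := by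
      intro p hp
      rcases hp.eq_or_lt with rfl | hp
      · exact ⟨y₀, hy₀, hhead.symm⟩
      · exact htail p hp
    obtain ⟨y, hy⟩ := exists_seq_of_forall_ge htail'
    refine ⟨p₀, b, y, hy, ?_⟩
    cases p₀ with
    | zero => exact Or.inl rfl
    | succ q =>
      refine Or.inr (Or.inr ⟨by omega, hmin, fun hq => ?_⟩)
      rw [act_seg_succ_iff] at hrest
      have heq := hrest.1
      rw [← hmin q (by omega)] at heq
      change μ q ∈ X.Hxi at hq
      rcases X.exists_xiB_of_mem_Hxi hq b with ⟨z, hz⟩ | ⟨z, hz⟩ <;> rw [hz, edgeAct_carry] at heq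
      · exact X.xiB_ne_xiB_not _ _ _ heq.symm
      · exact X.xiB_ne_xiB_not _ _ _ heq.symm
  · rw [hy₀, edgeAct_carry, Bool.not_not] at hhead
    obtain ⟨y, hy⟩ := exists_seq_of_forall_ge htail
    exact ⟨p₀ + 1, b, y, hy, Or.inr (Or.inl ⟨by omega, hmin, y₀, hy₀, hhead.symm⟩)⟩

lemma act_carry_seg_of_forall_ge {μ ν : ℕ → X.EE} {b : Bool} {y : ℕ → X.HE} {k : ℕ}
    (hy : ∀ p, k ≤ p → μ p = X.xiB b (y p) ∧ ν p = X.xiB (!b) (y p))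
    (hk : X.act (carry b) (X.seg μ k) = X.seg ν k) {n : ℕ} (hn : k ≤ n) :
    X.act (carry b) (X.seg μ n) = X.seg ν n := by
  induction n, hn using Nat.le_induction with
  | base => exact hk
  | succ n hn ih =>
    rw [act_seg_succ_iff, (hy n hn).1, (hy n hn).2, edgeAct_carry, edgeRes_carry]
    exact ⟨rfl, ih⟩

lemma PutnamRel.asympEquiv {X : EmbPair} {μ ν : ℕ → X.EE} (h : X.PutnamRel μ ν) :
    X.AsympEquiv μ ν := by
  rcases h with rfl | ⟨k, b, y, hy, hcase⟩
  · exact ⟨{0}, fun _ => 0, fun n => ⟨by simp, rfl, X.act_zero _⟩⟩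
  have hr : ∀ p, k ≤ p → X.rE (μ p) = X.rE (ν p) := fun p hp => by
    rw [(hy p hp).1, (hy p hp).2]
    exact X.rE_xiB _ _ _
  suffices H : (∀ p < k, X.rE (μ p) = X.rE (ν p)) ∧ X.act (carry b) (X.seg μ k) = X.seg ν k ∧
      ∀ n < k, X.act (carry b) (X.seg μ (n + 1)) = X.seg ν (n + 1) ∨
        ∀ p < n + 1, μ p = ν p by
    obtain ⟨hr', hk, hlow⟩ := H
    have hall : ∀ n, ∃ m ∈ ({0, carry b} : Finset ℤ),
        X.act m (X.seg μ (n + 1)) = X.seg ν (n + 1) := by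
      intro n
      rcases lt_or_ge n k with hn | hn
      · rcases hlow n hn with h | h
        · exact ⟨carry b, by simp, h⟩
        · exact ⟨0, by simp, by rw [act_zero, seg_eq_seg_iff]; exact h⟩
      · exact ⟨carry b, by simp, X.act_carry_seg_of_forall_ge hy hk (by omega)⟩
    choose g hg hact using hall
    exact ⟨_, g, fun n => ⟨hg n, (lt_or_ge n k).elim (hr' n) (hr n), hact n⟩⟩
  rcases hcase with rfl | ⟨h1, heq, y', hμ', hν'⟩ | ⟨h1, heq, hnot⟩
  · exact ⟨by simp, rfl, by simp⟩
  · obtain ⟨q, rfl⟩ : ∃ q, k = q + 1 := ⟨k - 1, by omega⟩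
    simp only [Nat.add_sub_cancel] at heq hμ' hν'
    have hk : X.act (carry b) (X.seg μ (q + 1)) = X.seg ν (q + 1) := by
      rw [act_seg_succ_iff, hμ', hν', edgeAct_carry, edgeRes_carry_not, act_zero, Bool.not_not,
        seg_eq_seg_iff]
      exact ⟨rfl, heq⟩
    refine ⟨fun p hp => ?_, hk, fun n hn => ?_⟩
    · rcases Nat.lt_succ_iff_lt_or_eq.1 hp with hp | rfl
      · rw [heq p hp]
      · rw [hμ', hν']
        exact X.rE_xiB _ _ _
    · rcases Nat.lt_succ_iff_lt_or_eq.1 hn with hn | rfl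
      · exact Or.inr fun p hp => heq p (by omega)
      · exact Or.inl hk
  · obtain ⟨q, rfl⟩ : ∃ q, k = q + 1 := ⟨k - 1, by omega⟩
    simp only [Nat.add_sub_cancel] at hnot
    refine ⟨fun p hp => by rw [heq p hp], ?_, fun n hn => Or.inr fun p hp => heq p (by omega)⟩
    rw [act_seg_succ_iff, X.edgeAct_of_notMem hnot, X.edgeRes_of_notMem hnot, act_zero,
      seg_eq_seg_iff]
    exact ⟨heq q (by omega), fun p hp => heq p (by omega)⟩

end EmbPair

open EmbPair in
/-- for an embedding pair, Putnam's relation `∼ξ` equals the asymptotic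
equivalence relation `∼_ae` on `E^{-∞}`. -/
theorem statement15 (X : EmbPair) (μ ν : ℕ → X.EE) (hμ : X.IsLPath μ) (hν : X.IsLPath ν) :
    X.PutnamRel μ ν ↔ X.AsympEquiv μ ν := by
  exact ⟨PutnamRel.asympEquiv, AsympEquiv.putnamRel⟩
end

section
/- Let (A,B) be a Katsura pair with B ∈ M_N({0,1}) such that the KEP-action (G_B, E_A) is regular. Let μ, ν be left-infinite paths of E_A with r(μ_k) = r(ν_k) and s(μ_k) = s(ν_k) for all k < 0, and with B(μ_k) = 1 for all k < 0. Then μ ∼_ae ν if and only if the series Σ_{k=-1}^{-∞} #(μ_k)/A_{μ[k,-1]} and Σ_{k=-1}^{-∞} #(ν_k)/A_{ν[k,-1]} have equal values in ℝ/ℤ, where A_{μ[k,-1]} = ∏_{j=k}^{-1} A(μ_j). -/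
open scoped Classical

/-- A Katsura pair on a vertex set `V`: matrices `A` (natural entries) and `B` (integer
entries) with `A i j = 0 → B i j = 0`. -/
structure KatsuraPair (V : Type) where
  A : V → V → ℕ
  B : V → V → ℤ
  zero : ∀ i j, A i j = 0 → B i j = 0

namespace KatsuraPair

variable {V : Type}

/-- An edge `e_{i,j,m}` (with `0 ≤ m < A i j`) of the graph `E_A`; the range is `i` and the
source is `j`. -/
structure Edge (P : KatsuraPair V) where
  i : V
  j : V
  m : ℕ
  hm : m < P.A i j

variable {P : KatsuraPair V}

/-- A finite path `μ = μ₁⋯μₙ`: consecutive edges satisfy `s(μₜ) = r(μₜ₊₁)`. -/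
def IsPath (μ : List (Edge P)) : Prop := μ.Chain' (fun e f => e.j = f.i)

/-- `r(μ) = v` (vacuously true for the empty path, viewed as a vertex). -/
def rangeIs (μ : List (Edge P)) (v : V) : Prop := ∀ e ∈ μ.head?, e.i = v

/-- The source of a path whose range is `v` (so `s` of the empty path at `v` is `v`). -/
def src (v : V) (μ : List (Edge P)) : V := (μ.getLast?).elim v (fun e => e.j)

/-- `A_μ`, the product of the `A`-entries along `μ` (empty product is 1). -/
def Aprod (μ : List (Edge P)) : ℕ := (μ.map (fun e => P.A e.i e.j)).prod

/-- `B_μ`, the product of the `B`-entries along `μ` (empty product is 1). -/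
def Bprod (μ : List (Edge P)) : ℤ := (μ.map (fun e => P.B e.i e.j)).prod

/-- `a^k · e_{i,j,m} = e_{i,j,m̂}` where `k·B i j + m = k̂·(A i j) + m̂`, `0 ≤ m̂ < A i j`. -/
def edgeAct (k : ℤ) (e : Edge P) : Edge P where
  i := e.i
  j := e.j
  m := ((k * P.B e.i e.j + (e.m : ℤ)) % (P.A e.i e.j : ℤ)).toNat
  hm := by
    have hA : 0 < P.A e.i e.j := Nat.lt_of_le_of_lt (Nat.zero_le _) e.hm
    have hA' : (0 : ℤ) < (P.A e.i e.j : ℤ) := by exact_mod_cast hA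
    have h1 : 0 ≤ (k * P.B e.i e.j + (e.m : ℤ)) % (P.A e.i e.j : ℤ) :=
      Int.emod_nonneg _ hA'.ne'
    have h2 : (k * P.B e.i e.j + (e.m : ℤ)) % (P.A e.i e.j : ℤ) < (P.A e.i e.j : ℤ) :=
      Int.emod_lt_of_pos _ hA'
    omega

/-- `a^k|_{e_{i,j,m}} = a^{k̂}` where `k·B i j + m = k̂·(A i j) + m̂`, `0 ≤ m̂ < A i j`. -/
def edgeRes (k : ℤ) (e : Edge P) : ℤ := (k * P.B e.i e.j + (e.m : ℤ)) / (P.A e.i e.j : ℤ)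

/-- The action of `a^k` on finite paths: `a^k · (eν) = (a^k · e)(a^k|_e · ν)`. -/
def act : ℤ → List (Edge P) → List (Edge P)
  | _, [] => []
  | k, e :: ν => edgeAct k e :: act (edgeRes k e) ν

/-- The restriction along a path: `a^k|_{eν} = (a^k|_e)|_ν`; `res k μ` is the integer with
`a^k|_μ = a^{res k μ}`. -/
def res : ℤ → List (Edge P) → ℤ
  | k, [] => k
  | k, e :: ν => res (edgeRes k e) ν

/-- `a^k` and `a^l` act equally at the vertex `v`. -/
def ActEq (P : KatsuraPair V) (k l : ℤ) (v : V) : Prop :=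
  ∀ μ : List (Edge P), IsPath μ → rangeIs μ v → act k μ = act l μ

/-- The KEP-action `(G_B, E_A)` is contracting. -/
def Contracting (P : KatsuraPair V) : Prop :=
  ∃ F : Finset ℤ, ∀ k : ℤ, ∀ v : V, ∃ n : ℕ, ∀ μ : List (Edge P),
    IsPath μ → rangeIs μ v → n ≤ μ.length →
    ∃ l ∈ F, ActEq P (res k μ) l (src v μ)

/-- The KEP-action `(G_B, E_A)` is regular. -/
def Regular (P : KatsuraPair V) : Prop :=
  ∀ k : ℤ, ∀ v : V, ∃ K : ℕ, ∀ μ : List (Edge P),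
    IsPath μ → rangeIs μ v → K ≤ μ.length → act k μ = μ →
    ActEq P (res k μ) 0 (src v μ)

/-- `v ∈ E⁰_{A,<∞}`: the quantity `A_μ / gcd(A_μ, |B_μ|)` is bounded over paths `μ` with
range `v` and `B_μ ≠ 0`. -/
def FiniteVertex (P : KatsuraPair V) (v : V) : Prop :=
  ∃ C : ℕ, ∀ μ : List (Edge P), IsPath μ → rangeIs μ v → Bprod μ ≠ 0 →
    Aprod μ / Nat.gcd (Aprod μ) (Bprod μ).natAbs ≤ C

/-- An edge of `E_{A,∞}`: `B` nonzero and source in `E⁰_{A,∞}`. -/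
def InfEdge (e : Edge P) : Prop := P.B e.i e.j ≠ 0 ∧ ¬ FiniteVertex P e.j

/-- An edge of `E_{A,<∞}`: `B` nonzero and range in `E⁰_{A,<∞}`. -/
def FinEdge (e : Edge P) : Prop := P.B e.i e.j ≠ 0 ∧ FiniteVertex P e.i

/-- The infinite part `(A_∞, B_∞)` of a Katsura pair. -/
def infinitePart (P : KatsuraPair V) : KatsuraPair {v : V // ¬ FiniteVertex P v} where
  A := fun i j => if P.B i.1 j.1 = 0 then 0 else P.A i.1 j.1
  B := fun i j => P.B i.1 j.1
  zero := fun i j h => by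
    by_cases hb : P.B i.1 j.1 = 0
    · exact hb
    · simp only [if_neg hb] at h
      exact P.zero _ _ h

/-- The finite part `(A_{<∞}, B_{<∞})` of a Katsura pair. -/
def finitePart (P : KatsuraPair V) : KatsuraPair {v : V // FiniteVertex P v} where
  A := fun i j => if P.B i.1 j.1 = 0 then 0 else P.A i.1 j.1
  B := fun i j => P.B i.1 j.1
  zero := fun i j h => by
    by_cases hb : P.B i.1 j.1 = 0
    · exact hb
    · simp only [if_neg hb] at h
      exact P.zero _ _ h

end KatsuraPair

namespace KatsuraPair

variable {V : Type} {P : KatsuraPair V}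

/-- A left-infinite path `⋯μ₋₂μ₋₁`; index `p : ℕ` encodes position `-(p+1)`. -/
def IsLPath (μ : ℕ → Edge P) : Prop := ∀ n, (μ (n + 1)).j = (μ n).i

/-- The finite segment `μ₋ₖ⋯μ₋₁` of a left-infinite path. -/
def seg (μ : ℕ → Edge P) (k : ℕ) : List (Edge P) := ((List.range k).reverse).map μ

/-- Asymptotic equivalence of left-infinite paths: implementing groupoid elements lie in a
finite set `F ⊆ ℤ`. -/
def AsympEquiv (μ ν : ℕ → Edge P) : Prop :=
  ∃ F : Finset ℤ, ∃ g : ℕ → ℤ, ∀ n : ℕ,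
    g n ∈ F ∧ (μ n).i = (ν n).i ∧ act (g n) (seg μ (n + 1)) = seg ν (n + 1)

end KatsuraPair

namespace KatsuraPair

variable {V : Type} {P : KatsuraPair V}

/-- The mixed-radix value of a finite path, whose first edge is the least significant digit. -/
def val : List (Edge P) → ℕ
  | [] => 0
  | e :: l => e.m + P.A e.i e.j * val l

@[ext]
lemma Edge.ext_of_fields {e f : Edge P} (hi : e.i = f.i) (hj : e.j = f.j) (hm : e.m = f.m) :
    e = f := by
  cases e
  cases f
  simp_all

lemma Edge.A_pos (e : Edge P) : 0 < P.A e.i e.j := Nat.zero_lt_of_lt e.hm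

lemma seg_zero (μ : ℕ → Edge P) : seg μ 0 = [] := rfl

lemma seg_succ (μ : ℕ → Edge P) (n : ℕ) : seg μ (n + 1) = μ n :: seg μ n := by
  simp [seg, List.range_succ]

lemma Aprod_seg_zero (μ : ℕ → Edge P) : Aprod (seg μ 0) = 1 := rfl

lemma Aprod_seg_succ (μ : ℕ → Edge P) (n : ℕ) :
    Aprod (seg μ (n + 1)) = P.A (μ n).i (μ n).j * Aprod (seg μ n) := by
  simp [seg_succ, Aprod]

lemma val_seg_zero (μ : ℕ → Edge P) : val (seg μ 0) = 0 := rfl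

lemma val_seg_succ (μ : ℕ → Edge P) (n : ℕ) :
    val (seg μ (n + 1)) = (μ n).m + P.A (μ n).i (μ n).j * val (seg μ n) := by
  rw [seg_succ, val]

lemma Aprod_seg_pos (μ : ℕ → Edge P) (n : ℕ) : 0 < Aprod (seg μ n) := by
  induction n with
  | zero => simp [Aprod_seg_zero]
  | succ n ih => rw [Aprod_seg_succ]; exact Nat.mul_pos (μ n).A_pos ih

lemma monotone_Aprod_seg (μ : ℕ → Edge P) : Monotone fun n => Aprod (seg μ n) :=
  monotone_nat_of_le_succ fun n => by
    rw [Aprod_seg_succ]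
    exact Nat.le_mul_of_pos_left _ (μ n).A_pos

lemma Aprod_seg_congr {μ ν : ℕ → Edge P} (hr : ∀ p, (μ p).i = (ν p).i)
    (hs : ∀ p, (μ p).j = (ν p).j) (n : ℕ) : Aprod (seg μ n) = Aprod (seg ν n) := by
  induction n with
  | zero => rfl
  | succ n ih => rw [Aprod_seg_succ, Aprod_seg_succ, ih, hr, hs]

lemma emod_eq_and_dvd_ediv_iff {a b x r y : ℤ} (ha : 0 < a) (hr : 0 ≤ r) (hra : r < a) :
    (x % a = r ∧ b ∣ x / a + y) ↔ a * b ∣ x - r + a * y := by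
  constructor
  · rintro ⟨h, c, hc⟩
    refine ⟨c, ?_⟩
    linear_combination a * hc + h - Int.mul_ediv_add_emod x a
  · rintro ⟨c, hc⟩
    have hx : x = r + a * (b * c - y) := by linear_combination hc
    have hmod : x % a = r := by rw [hx, Int.add_mul_emod_self_left, Int.emod_eq_of_lt hr hra]
    have hdiv : x / a = b * c - y := by
      rw [hx, Int.add_mul_ediv_left _ _ ha.ne', Int.ediv_eq_zero_of_lt hr hra, zero_add]
    exact ⟨hmod, c, by rw [hdiv]; ring⟩

lemma edgeAct_eq_iff {e f : Edge P} (hi : e.i = f.i) (hj : e.j = f.j)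
    (hB : P.B e.i e.j = 1) (k : ℤ) :
    edgeAct k e = f ↔ (k + e.m) % (P.A e.i e.j : ℤ) = f.m := by
  have hpos : 0 ≤ (k + e.m) % (P.A e.i e.j : ℤ) :=
    Int.emod_nonneg _ (by exact_mod_cast e.A_pos.ne')
  constructor
  · rintro rfl
    simp [edgeAct, hB, hpos]
  · intro h
    ext
    · exact hi
    · exact hj
    · simp [edgeAct, hB, h]

/-- Along edges with `B = 1`, the generator acts as an odometer. -/
lemma act_seg_eq_iff {μ ν : ℕ → Edge P} (hr : ∀ p, (μ p).i = (ν p).i)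
    (hs : ∀ p, (μ p).j = (ν p).j) (hB : ∀ p, P.B (μ p).i (μ p).j = 1) (n : ℕ) (k : ℤ) :
    act k (seg μ n) = seg ν n ↔
      (Aprod (seg μ n) : ℤ) ∣ k + ((val (seg μ n) : ℤ) - val (seg ν n)) := by
  induction n generalizing k with
  | zero => simp [seg_zero, act, Aprod]
  | succ n ih =>
    have hν : ((ν n).m : ℤ) < P.A (μ n).i (μ n).j := by
      rw [hr, hs]
      exact_mod_cast (ν n).hm
    rw [Aprod_seg_succ, val_seg_succ, val_seg_succ, seg_succ, seg_succ, act, List.cons.injEq,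
      edgeAct_eq_iff (hr n) (hs n) (hB n), ih, edgeRes, hB n, mul_one,
      emod_eq_and_dvd_ediv_iff (by exact_mod_cast (μ n).A_pos) (by positivity) hν,
      ← hr n, ← hs n]
    push_cast
    ring_nf

lemma isPath_seg {μ : ℕ → Edge P} (hμ : IsLPath μ) (n : ℕ) : IsPath (seg μ n) := by
  induction n with
  | zero => exact List.isChain_nil
  | succ n ih =>
    rw [seg_succ]
    refine List.isChain_cons.2 ⟨fun e he => ?_, ih⟩
    cases n with
    | zero => simp [seg_zero] at he
    | succ n =>
      simp only [seg_succ, List.head?_cons, Option.mem_def, Option.some.injEq] at he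
      rw [← he, hμ n]

lemma rangeIs_seg_succ (μ : ℕ → Edge P) (n : ℕ) : rangeIs (seg μ (n + 1)) (μ n).i := by
  simp [rangeIs, seg_succ]

lemma src_seg_succ (μ : ℕ → Edge P) (n : ℕ) (v : V) : src v (seg μ (n + 1)) = (μ 0).j := by
  simp [src, seg, List.range_succ_eq_map]

lemma res_seg {μ : ℕ → Edge P} (hA : ∀ p, P.A (μ p).i (μ p).j = 1)
    (hB : ∀ p, P.B (μ p).i (μ p).j = 1) (k : ℤ) (n : ℕ) : res k (seg μ n) = k := by
  induction n with
  | zero => rfl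
  | succ n ih =>
    have hm : (μ n).m = 0 := by
      have := (μ n).hm
      rw [hA] at this
      omega
    simpa [seg_succ, res, edgeRes, hA, hB, hm] using ih

/-- For a regular action, a left-infinite path with `B = 1` whose `A`-entries are eventually `1`
has all its `A`-entries equal to `1`. -/
lemma Regular.Aprod_seg_eq_one [Finite V] (hreg : Regular P) {μ : ℕ → Edge P} (hμ : IsLPath μ)
    (hB : ∀ p, P.B (μ p).i (μ p).j = 1) {N : ℕ}
    (hA : ∀ p, N ≤ p → P.A (μ p).i (μ p).j = 1) : Aprod (seg μ N) = 1 := by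
  cases N with
  | zero => rfl
  | succ N =>
    have := Fintype.ofFinite V
    choose K hK using hreg 1
    let L := Finset.univ.sup K
    let τ : ℕ → Edge P := fun p => μ (p + (N + 1))
    have hτ : IsLPath τ := fun n => by
      simpa only [τ, Nat.add_right_comm n 1 (N + 1)] using hμ (n + (N + 1))
    have hτA : ∀ p, P.A (τ p).i (τ p).j = 1 := fun p => hA _ (Nat.le_add_left _ _)
    have hτB : ∀ p, P.B (τ p).i (τ p).j = 1 := fun p => hB _
    have hτD : ∀ n, Aprod (seg τ n) = 1 := fun n => by
      induction n with
      | zero => rfl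
      | succ n ih => rw [Aprod_seg_succ, ih, hτA]
    have hlen : K (τ L).i ≤ (seg τ (L + 1)).length := by
      have : K (τ L).i ≤ L := Finset.le_sup (Finset.mem_univ _)
      simp only [seg, List.length_map, List.length_reverse, List.length_range]
      omega
    have hact := hK (τ L).i _ (isPath_seg hτ _) (rangeIs_seg_succ τ L) hlen
      ((act_seg_eq_iff (fun _ => rfl) (fun _ => rfl) hτB _ _).2 (by simp [hτD]))
    rw [res_seg hτA hτB, src_seg_succ] at hact
    have hsrc : (τ 0).j = (μ N).i := by
      simpa only [τ, Nat.zero_add] using hμ N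
    have h1 := hact _ (isPath_seg hμ (N + 1)) (hsrc ▸ rangeIs_seg_succ μ N)
    rw [(act_seg_eq_iff (fun _ => rfl) (fun _ => rfl) hB (N + 1) 0).2 (by simp),
      act_seg_eq_iff (fun _ => rfl) (fun _ => rfl) hB, sub_self, add_zero] at h1
    exact Nat.dvd_one.1 (by exact_mod_cast h1)

lemma Regular.tendsto_Aprod_seg_or [Finite V] (hreg : Regular P) {μ : ℕ → Edge P}
    (hμ : IsLPath μ) (hB : ∀ p, P.B (μ p).i (μ p).j = 1) :
    Filter.Tendsto (fun n => Aprod (seg μ n)) Filter.atTop Filter.atTop ∨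
      ∀ p, P.A (μ p).i (μ p).j = 1 := by
  rcases tendsto_atTop_of_monotone (monotone_Aprod_seg μ) with h | ⟨c, hc⟩
  · exact Or.inl h
  · right
    obtain ⟨N, hN⟩ := Filter.eventually_atTop.1 ((nhds_discrete ℕ ▸ hc).eventually
      (Filter.eventually_pure.2 rfl : ∀ᶠ x in pure c, x = c))
    have hA : ∀ p, N ≤ p → P.A (μ p).i (μ p).j = 1 := fun p hp => by
      have h := Aprod_seg_succ μ p
      rw [hN p hp, hN (p + 1) (by omega)] at h
      have hc : 0 < c := hN p hp ▸ Aprod_seg_pos μ p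
      exact Nat.eq_of_mul_eq_mul_right hc (by rw [← h, one_mul])
    intro p
    have h := hreg.Aprod_seg_eq_one hμ hB (N := max N (p + 1))
      fun q hq => hA q (le_trans (le_max_left _ _) hq)
    have h1 : Aprod (seg μ (p + 1)) ≤ 1 := 
      (monotone_Aprod_seg μ (le_max_right N (p + 1))).trans h.le
    have h2 := Aprod_seg_pos μ (p + 1)
    exact Nat.eq_one_of_mul_eq_one_right (by rw [← Aprod_seg_succ]; omega)

lemma sum_range_eq_val_div (μ : ℕ → Edge P) (n : ℕ) :
    ∑ p ∈ Finset.range n, ((μ p).m : ℝ) / (Aprod (seg μ (p + 1)) : ℝ) =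
      (val (seg μ n) : ℝ) / Aprod (seg μ n) := by
  induction n with
  | zero => simp [val_seg_zero]
  | succ n ih =>
    have h1 : (Aprod (seg μ n) : ℝ) ≠ 0 := by exact_mod_cast (Aprod_seg_pos μ n).ne'
    have h2 : (P.A (μ n).i (μ n).j : ℝ) ≠ 0 := by exact_mod_cast (μ n).A_pos.ne'
    rw [Finset.sum_range_succ, ih, val_seg_succ, Aprod_seg_succ]
    push_cast
    field_simp
    ring

lemma antitone_val_succ_div (μ : ℕ → Edge P) :
    Antitone fun n => ((val (seg μ n) : ℝ) + 1) / Aprod (seg μ n) :=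
  antitone_nat_of_succ_le fun n => by
    have h1 : (0 : ℝ) < Aprod (seg μ n) := by exact_mod_cast Aprod_seg_pos μ n
    have h2 : (0 : ℝ) < P.A (μ n).i (μ n).j := by exact_mod_cast (μ n).A_pos
    have h3 : ((μ n).m : ℝ) + 1 ≤ P.A (μ n).i (μ n).j := by exact_mod_cast (μ n).hm
    rw [val_seg_succ, Aprod_seg_succ]
    push_cast
    rw [← mul_div_mul_left _ (Aprod (seg μ n) : ℝ) h2.ne']
    gcongr
    linarith

lemma val_lt_Aprod (μ : ℕ → Edge P) (n : ℕ) : val (seg μ n) < Aprod (seg μ n) := by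
  have h := antitone_val_succ_div μ (Nat.zero_le n)
  have h1 : (0 : ℝ) < Aprod (seg μ n) := by exact_mod_cast Aprod_seg_pos μ n
  simp only [val_seg_zero, Aprod_seg_zero, Nat.cast_zero, Nat.cast_one, zero_add, div_one,
    div_le_one h1] at h
  exact_mod_cast h

lemma summable_digits (μ : ℕ → Edge P) :
    Summable fun p : ℕ => ((μ p).m : ℝ) / (Aprod (seg μ (p + 1)) : ℝ) :=
  summable_of_sum_range_le (c := 1) (fun _ => by positivity) fun n => by
    rw [sum_range_eq_val_div]
    exact div_le_one_of_le₀ (by exact_mod_cast (val_lt_Aprod μ n).le) (by positivity)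

lemma val_le_mul_tsum (μ : ℕ → Edge P) (n : ℕ) :
    (val (seg μ n) : ℝ) ≤
      (∑' p : ℕ, ((μ p).m : ℝ) / (Aprod (seg μ (p + 1)) : ℝ)) * Aprod (seg μ n) := by
  rw [← div_le_iff₀ (by exact_mod_cast Aprod_seg_pos μ n), ← sum_range_eq_val_div]
  exact (summable_digits μ).sum_le_tsum _ fun _ _ => by positivity

lemma mul_tsum_le_val_succ (μ : ℕ → Edge P) (n : ℕ) :
    (∑' p : ℕ, ((μ p).m : ℝ) / (Aprod (seg μ (p + 1)) : ℝ)) * Aprod (seg μ n) ≤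
      (val (seg μ n) : ℝ) + 1 := by
  rw [← le_div_iff₀ (by exact_mod_cast Aprod_seg_pos μ n)]
  refine le_of_tendsto (summable_digits μ).hasSum.tendsto_sum_nat ?_
  filter_upwards [Filter.eventually_ge_atTop n] with m hm
  rw [sum_range_eq_val_div]
  exact le_trans (div_le_div_of_nonneg_right (by linarith) (by positivity)) (antitone_val_succ_div μ hm)

end KatsuraPair

open KatsuraPair in
/-- for a regular KEP-action with `B ∈ M_N({0,1})` and left-infinite paths
`μ, ν` with the same vertex sequences and `B(μ_k) = 1` throughout, `μ ∼_ae ν` iff the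
series `Σ_{k=-1}^{-∞} #(μ_k)/A_{μ[k,-1]}` and `Σ_{k=-1}^{-∞} #(ν_k)/A_{ν[k,-1]}` have equal
values in `ℝ/ℤ`. -/
theorem statement18 (N : ℕ) (hN : 0 < N) (P : KatsuraPair (Fin N))
    (hB : ∀ i j, P.B i j = 0 ∨ P.B i j = 1) (hreg : Regular P)
    (μ ν : ℕ → Edge P) (hμ : IsLPath μ) (hν : IsLPath ν)
    (hr : ∀ p : ℕ, (μ p).i = (ν p).i) (hs : ∀ p : ℕ, (μ p).j = (ν p).j)
    (hB1 : ∀ p : ℕ, P.B (μ p).i (μ p).j = 1) :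
    AsympEquiv μ ν ↔
      ((∑' p : ℕ, ((μ p).m : ℝ) / (Aprod (seg μ (p + 1)) : ℝ) : ℝ) : AddCircle (1 : ℝ)) =
      ((∑' p : ℕ, ((ν p).m : ℝ) / (Aprod (seg ν (p + 1)) : ℝ) : ℝ) : AddCircle (1 : ℝ)) := by
  have hD := Aprod_seg_congr hr hs
  have hμl := val_le_mul_tsum μ
  have hμu := mul_tsum_le_val_succ μ
  have hνl := val_le_mul_tsum ν
  have hνu := mul_tsum_le_val_succ ν
  simp only [← hD] at hνl hνu ⊢
  have hdig : ∀ p, P.A (μ p).i (μ p).j = 1 → (μ p).m = 0 ∧ (ν p).m = 0 := fun p hp => by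
    have h1 := (μ p).hm
    have h2 := (ν p).hm
    rw [← hr, ← hs] at h2
    omega
  have hS : (∀ p, P.A (μ p).i (μ p).j = 1) →
      ∑' p : ℕ, ((μ p).m : ℝ) / (Aprod (seg μ (p + 1)) : ℝ) =
        ∑' p : ℕ, ((ν p).m : ℝ) / (Aprod (seg μ (p + 1)) : ℝ) := fun h => by
    simp [fun p => (hdig p (h p)).1, fun p => (hdig p (h p)).2]
  generalize (∑' p : ℕ, ((μ p).m : ℝ) / (Aprod (seg μ (p + 1)) : ℝ)) = S at *
  generalize (∑' p : ℕ, ((ν p).m : ℝ) / (Aprod (seg μ (p + 1)) : ℝ)) = T at *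
  have hcircle : ((S : AddCircle (1 : ℝ)) = (T : AddCircle (1 : ℝ))) ↔
      T - S ∈ Set.range ((↑) : ℤ → ℝ) := by
    rw [eq_comm, ← sub_eq_zero, ← AddCircle.coe_sub, AddCircle.coe_eq_zero_iff]
    simp
  rw [hcircle]
  constructor
  · rintro ⟨F, g, hg⟩
    rcases hreg.tendsto_Aprod_seg_or hμ hB1 with hlim | hA
    · choose hF _ hact using hg
      choose z hz using fun n => (act_seg_eq_iff hr hs hB1 _ _).1 (hact n)
      obtain ⟨C, hC⟩ : ∃ C : ℝ, ∀ k ∈ F, |(k : ℝ)| ≤ C :=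
        ⟨∑ k ∈ F, |(k : ℝ)|, fun k hk =>
          Finset.single_le_sum (f := fun k : ℤ => |(k : ℝ)|) (fun _ _ => abs_nonneg _) hk⟩
      have hbound : ∀ n, ‖((-z n : ℤ) : ℝ) - (T - S)‖ ≤ (C + 1) / Aprod (seg μ (n + 1)) := by
        intro n
        have hpos : (0 : ℝ) < Aprod (seg μ (n + 1)) := by exact_mod_cast Aprod_seg_pos μ (n + 1)
        have hzn : (g n : ℝ) + ((val (seg μ (n + 1)) : ℝ) - val (seg ν (n + 1))) =
          Aprod (seg μ (n + 1)) * z n := by exact_mod_cast hz n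
        have hgn := abs_le.1 (hC _ (hF n))
        have h1 := hμl (n + 1)
        have h2 := hμu (n + 1)
        have h3 := hνl (n + 1)
        have h4 := hνu (n + 1)
        rw [Real.norm_eq_abs, abs_le, ← neg_div, div_le_iff₀ hpos, le_div_iff₀ hpos]
        push_cast
        constructor <;> nlinarith
      have htend : Filter.Tendsto (fun n => ((-z n : ℤ) : ℝ)) Filter.atTop (nhds (T - S)) := by
        rw [tendsto_iff_norm_sub_tendsto_zero]
        refine squeeze_zero (fun _ => norm_nonneg _) hbound ?_
        exact Filter.Tendsto.div_atTop tendsto_const_nhds (tendsto_natCast_atTop_atTop.comp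
          (hlim.comp (Filter.tendsto_add_atTop_nat 1)))
      exact Int.isClosedEmbedding_coe_real.isClosed_range.mem_of_tendsto htend
        (Filter.Eventually.of_forall fun _ => Set.mem_range_self _)
    · exact ⟨0, by simp [hS hA]⟩
  · rintro ⟨z, hz⟩
    let k : ℕ → ℤ := fun n =>
      (val (seg ν (n + 1)) : ℤ) - val (seg μ (n + 1)) - z * Aprod (seg μ (n + 1))
    refine ⟨Finset.Icc (-1) 1, k, fun n => ⟨?_, hr n, ?_⟩⟩
    · have h1 := hμl (n + 1)
      have h2 := hμu (n + 1)
      have h3 := hνl (n + 1)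
      have h4 := hνu (n + 1)
      have hk : (k n : ℝ) = (val (seg ν (n + 1)) : ℝ) - val (seg μ (n + 1)) -
          (T - S) * Aprod (seg μ (n + 1)) := by
        rw [← hz]
        simp [k]
      rw [Finset.mem_Icc]
      constructor <;> rify <;> rw [hk] <;> linarith
    · rw [act_seg_eq_iff hr hs hB1]
      exact ⟨-z, by simp only [k]; ring⟩
end
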